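/- arXiv:0705.3839 — 4 statements merged into one kernel-verified Lean document; each statement's English description precedes it below -/
import Mathlib

section
/- Let (V,b) and (V',b') be isometric finite-dimensional metric spaces over F (possibly singular). Then every isometry φ : E → E' between subspaces E ⊆ V and E' ⊆ V' satisfying φ(E ∩ V^⊥) = E' ∩ V'^⊥ can be extended to an isometry from V to V'. -/
open Module

namespace Witt

variable {F V V' : Type*} [Field F] [AddCommGroup V] [Module F V]
  [AddCommGroup V'] [Module F V']

/-- A linear equivalence `φ : E ≃ E'` between subspaces is an isometry if it
preserves the ambient bilinear forms. -/
def IsIsometryOn (B : LinearMap.BilinForm F V) (B' : LinearMap.BilinForm F V')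
    (E : Submodule F V) (E' : Submodule F V') (φ : E ≃ₗ[F] E') : Prop :=
  ∀ u v : E, B' (φ u : V') (φ v : V') = B (u : V) (v : V)

/-- A linear equivalence of the whole spaces which preserves the forms. -/
def IsIsometry (B : LinearMap.BilinForm F V) (B' : LinearMap.BilinForm F V')
    (ψ : V ≃ₗ[F] V') : Prop :=
  ∀ u v : V, B' (ψ u) (ψ v) = B u v

/-- The two metric spaces `(V,B)` and `(V',B')` are isometric. -/
def AreIsometric (B : LinearMap.BilinForm F V) (B' : LinearMap.BilinForm F V') : Prop :=
  ∃ ψ : V ≃ₗ[F] V', IsIsometry B B' ψ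

/-- The subspaces `N ⊆ V` and `N' ⊆ V'` are isometric with respect to the
restrictions of the ambient forms. -/
def SubIsometric (B : LinearMap.BilinForm F V) (B' : LinearMap.BilinForm F V')
    (N : Submodule F V) (N' : Submodule F V') : Prop :=
  ∃ ψ : N ≃ₗ[F] N', IsIsometryOn B B' N N' ψ

/-- A subspace is totally isotropic. -/
def TotIsotropic (B : LinearMap.BilinForm F V) (N : Submodule F V) : Prop :=
  ∀ u ∈ N, ∀ v ∈ N, B u v = 0

end Witt

open Module Witt

namespace Witt

section Extension

variable {F V : Type*} [Field F] [AddCommGroup V] [Module F V]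

/-- A functional vanishing on the radical of a symmetric form is represented by a vector. -/
theorem exists_apply_eq_of_ker_le [FiniteDimensional F V] {B : LinearMap.BilinForm F V}
    (hB : ∀ u v : V, B u v = B v u) {f : V →ₗ[F] F} (hf : LinearMap.ker B ≤ LinearMap.ker f) :
    ∃ w : V, ∀ v : V, B v w = f v := by
  have hle : LinearMap.range B ≤ (LinearMap.ker B).dualAnnihilator := by
    rintro _ ⟨w, rfl⟩
    rw [Submodule.mem_dualAnnihilator]
    intro v hv
    rw [hB, LinearMap.mem_ker.mp hv, LinearMap.zero_apply]
  have heq : LinearMap.range B = (LinearMap.ker B).dualAnnihilator := by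
    apply Submodule.eq_of_le_of_finrank_eq hle
    have h₁ := LinearMap.finrank_range_add_finrank_ker B
    have h₂ := Subspace.finrank_add_finrank_dualAnnihilator_eq (LinearMap.ker B)
    exact Nat.add_right_cancel (h₁.trans (h₂.symm.trans (add_comm _ _)))
  have hmem : f ∈ LinearMap.range B := by
    rw [heq, Submodule.mem_dualAnnihilator]
    exact fun v hv => hf hv
  obtain ⟨w, rfl⟩ := hmem
  exact ⟨w, fun v => hB v w⟩

theorem exists_functional_eq_one_of_notMem {K : Submodule F V} {z : V} (hz : z ∉ K) :
    ∃ f : V →ₗ[F] F, f z = 1 ∧ ∀ v ∈ K, f v = 0 := by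
  obtain ⟨f, hfz, hfK⟩ := Submodule.exists_le_ker_of_notMem hz
  refine ⟨(f z)⁻¹ • f, by simp [hfz], fun v hv => ?_⟩
  simp [LinearMap.mem_ker.mp (hfK hv)]

/-- An endomorphism preserving the form which is injective on the radical is an isometry. -/
theorem exists_isometry_of_injOn_ker [FiniteDimensional F V] {B : LinearMap.BilinForm F V}
    (σ : V →ₗ[F] V) (hσ : ∀ u v : V, B (σ u) (σ v) = B u v)
    (hinj : ∀ v ∈ LinearMap.ker B, σ v = 0 → v = 0) :
    ∃ τ : V ≃ₗ[F] V, IsIsometry B B τ ∧ ∀ v, τ v = σ v := by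
  have hσ_inj : Function.Injective σ := by
    rw [injective_iff_map_eq_zero]
    intro v hv
    refine hinj v ?_ hv
    rw [LinearMap.mem_ker]
    ext w
    rw [← hσ, hv]
    simp
  exact ⟨LinearEquiv.ofInjectiveEndo σ hσ_inj, fun u v => hσ u v, fun v => rfl⟩

/-- Transvection along a radical vector. -/
theorem exists_radical_transvection [FiniteDimensional F V] {B : LinearMap.BilinForm F V}
    (hB : ∀ u v : V, B u v = B v u) {u : V} (hu : u ∈ LinearMap.ker B) (f : V →ₗ[F] F)
    (hf : f u ≠ 1) :
    ∃ τ : V ≃ₗ[F] V, IsIsometry B B τ ∧ ∀ v, τ v = v - f v • u := by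
  have hu₁ : ∀ v, B u v = 0 := fun v => by rw [LinearMap.mem_ker.mp hu, LinearMap.zero_apply]
  have hu₂ : ∀ v, B v u = 0 := fun v => by rw [hB, hu₁]
  refine exists_isometry_of_injOn_ker (LinearMap.id - f.smulRight u) (fun a b => ?_)
    (fun v _ hv => ?_)
  · simp [hu₁, hu₂]
  · have hv' : v = f v • u := by simpa [sub_eq_zero] using hv
    have h : f v = f v * f u := by simpa using congrArg f hv'
    have hfv : f v = 0 := by
      by_contra h0
      exact hf (mul_left_cancel₀ h0 (by rw [mul_one]; exact h.symm))
    rw [hv', hfv, zero_smul]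

/-- Reflection in an anisotropic vector. -/
theorem exists_reflection [FiniteDimensional F V] {B : LinearMap.BilinForm F V}
    (hB : ∀ u v : V, B u v = B v u) {u : V} (hu : B u u ≠ 0) :
    ∃ τ : V ≃ₗ[F] V, IsIsometry B B τ ∧ ∀ v, τ v = v - (2 * B v u / B u u) • u := by
  obtain ⟨τ, hτ, hτv⟩ := exists_isometry_of_injOn_ker (B := B)
    (LinearMap.id - (2 / B u u) • (B u).smulRight u) (fun a b => by
      simp [hB a u]
      field_simp
      ring) (fun v hv h => by
      simpa [hB u v, LinearMap.mem_ker.mp hv] using h)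
  refine ⟨τ, hτ, fun v => ?_⟩
  rw [hτv]
  simp [smul_smul, hB u v]
  ring_nf

/-- Eichler transformation. -/
theorem exists_eichler [FiniteDimensional F V] (hchar : (2 : F) ≠ 0)
    {B : LinearMap.BilinForm F V}
    (hB : ∀ u v : V, B u v = B v u) {u w : V} (hu : B u u = 0) (huw : B u w = 0) :
    ∃ τ : V ≃ₗ[F] V, IsIsometry B B τ ∧
      ∀ v, τ v = v - B v w • u + B v u • w - (B w w / 2 * B v u) • u := by
  have hwu : B w u = 0 := by rw [hB, huw]
  obtain ⟨τ, hτ, hτv⟩ := exists_isometry_of_injOn_ker (B := B)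
    (LinearMap.id - (B w).smulRight u + (B u).smulRight w
      - (B w w / 2) • (B u).smulRight u) (fun a b => by
      simp [hB a u, hB a w, hu, huw, hwu]
      field_simp
      ring) (fun v hv h => by
      simpa [hB u v, hB w v, LinearMap.mem_ker.mp hv] using h)
  refine ⟨τ, hτ, fun v => ?_⟩
  rw [hτv]
  simp [smul_smul, hB u v, hB w v]

/-- Scaling of a hyperbolic pair. -/
theorem exists_hyperbolic_scaling [FiniteDimensional F V] {B : LinearMap.BilinForm F V}
    (hB : ∀ u v : V, B u v = B v u) {u w : V} (hu : B u u = 0) (hw : B w w = 0)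
    (huw : B u w = 1) {c : F} (hc : c ≠ 0) :
    ∃ τ : V ≃ₗ[F] V, IsIsometry B B τ ∧
      ∀ v, τ v = v + ((c - 1) * B v w) • u + ((c⁻¹ - 1) * B v u) • w := by
  have hwu : B w u = 1 := by rw [hB, huw]
  obtain ⟨τ, hτ, hτv⟩ := exists_isometry_of_injOn_ker (B := B)
    (LinearMap.id + (c - 1) • (B w).smulRight u + (c⁻¹ - 1) • (B u).smulRight w) (fun a b => by
      simp [hB a u, hB a w, hu, hw, huw, hwu]
      field_simp
      ring) (fun v hv h => by
      simpa [hB u v, hB w v, LinearMap.mem_ker.mp hv] using h)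
  refine ⟨τ, hτ, fun v => ?_⟩
  rw [hτv]
  simp [smul_smul, hB u v, hB w v]

/-- The isometry carrying `x` to `y` over `H` when `x - y` lies in the radical. -/
theorem exists_isometry_fixing_of_sub_mem_ker [FiniteDimensional F V]
    {B : LinearMap.BilinForm F V} (hB : ∀ u v : V, B u v = B v u) {H : Submodule F V} {x y : V}
    (hx : x ∉ H) (hy : y ∉ H) (hu : x - y ∈ LinearMap.ker B) :
    ∃ τ : V ≃ₗ[F] V, IsIsometry B B τ ∧ (∀ h ∈ H, τ h = h) ∧ τ x = y := by
  obtain ⟨f, hfx, hfH, hfu⟩ : ∃ f : V →ₗ[F] F, f x = 1 ∧ (∀ h ∈ H, f h = 0) ∧ f (x - y) ≠ 1 := by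
    by_cases hxu : x ∈ H ⊔ Submodule.span F {x - y}
    · obtain ⟨f, hfx, hfH⟩ := exists_functional_eq_one_of_notMem hx
      refine ⟨f, hfx, hfH, fun hfu => hy ?_⟩
      obtain ⟨h, hh, z, hz, hhz⟩ := Submodule.mem_sup.mp hxu
      obtain ⟨c, rfl⟩ := Submodule.mem_span_singleton.mp hz
      have hc : c = 1 := by
        have := congrArg f hhz
        rw [map_add, map_smul, hfH h hh, hfu, hfx] at this
        simpa using this
      have hyh : y = h := by
        rw [hc, one_smul] at hhz
        have : h - y = 0 := by
          have := sub_eq_zero.mpr hhz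
          rw [← this]; abel
        exact (sub_eq_zero.mp this).symm
      exact hyh ▸ hh
    · obtain ⟨f, hfx, hfK⟩ := exists_functional_eq_one_of_notMem hxu
      refine ⟨f, hfx, fun h hh => hfK h (Submodule.mem_sup_left hh), ?_⟩
      rw [hfK _ (Submodule.mem_sup_right (Submodule.mem_span_singleton_self _))]
      exact zero_ne_one
  obtain ⟨τ, hτ, hτv⟩ := exists_radical_transvection hB hu f hfu
  refine ⟨τ, hτ, fun h hh => ?_, ?_⟩
  · rw [hτv, hfH h hh, zero_smul, sub_zero]
  · rw [hτv, hfx, one_smul, sub_sub_cancel]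

/-- The isometry carrying `x` to `y` over `H` when `x - y` is isotropic and not in the radical. -/
theorem exists_isometry_fixing_of_isotropic [FiniteDimensional F V] (hchar : (2 : F) ≠ 0)
    {B : LinearMap.BilinForm F V} (hB : ∀ u v : V, B u v = B v u) {H : Submodule F V} {x y : V}
    (hrad : ∀ h ∈ H, x - h ∈ LinearMap.ker B ↔ y - h ∈ LinearMap.ker B)
    (hH : ∀ h ∈ H, B h (x - y) = 0) (hxu : B x (x - y) = 0) (huu : B (x - y) (x - y) = 0)
    (hu : x - y ∉ LinearMap.ker B) :
    ∃ τ : V ≃ₗ[F] V, IsIsometry B B τ ∧ (∀ h ∈ H, τ h = h) ∧ τ x = y := by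
  have hx_notMem : ∀ h ∈ H, x - h ∉ LinearMap.ker B := fun h hh hxh => hu <| by
    have := Submodule.sub_mem _ hxh ((hrad h hh).mp hxh)
    rwa [sub_sub_sub_cancel_right] at this
  obtain ⟨u, rfl⟩ : ∃ u, y = x - u := ⟨x - y, by abel⟩
  simp only [sub_sub_cancel] at *
  by_cases hx : x ∈ (H ⊔ LinearMap.ker B) ⊔ Submodule.span F {u}
  · obtain ⟨k, hk, z, hz, hkz⟩ := Submodule.mem_sup.mp hx
    obtain ⟨h, hh, r, hr, rfl⟩ := Submodule.mem_sup.mp hk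
    obtain ⟨c, rfl⟩ := Submodule.mem_span_singleton.mp hz
    have hc0 : c ≠ 0 := by
      rintro rfl
      refine hx_notMem h hh ?_
      rw [← hkz]
      simpa using hr
    have hc1 : c ≠ 1 := by
      rintro rfl
      refine hx_notMem h hh ((hrad h hh).mpr ?_)
      rw [← hkz]
      simpa using hr
    have hu' : u ∉ H ⊔ LinearMap.ker B := fun hu' => by
      obtain ⟨h', hh', r', hr', rfl⟩ := Submodule.mem_sup.mp hu'
      refine hx_notMem (h + c • h') (H.add_mem hh (H.smul_mem c hh')) ?_
      have : x - (h + c • h') = r + c • r' := by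
        rw [← hkz, smul_add]; abel
      rw [this]
      exact Submodule.add_mem _ hr (Submodule.smul_mem _ c hr')
    obtain ⟨f, hfu, hfK⟩ := exists_functional_eq_one_of_notMem hu'
    obtain ⟨w, hw⟩ := exists_apply_eq_of_ker_le (f := f) hB
      fun v hv => hfK v (Submodule.mem_sup_right hv)
    have huw : B u w = 1 := by rw [hw, hfu]
    have hwu : B w u = 1 := by rw [hB, huw]
    have hw'w' : B (w - (B w w / 2) • u) (w - (B w w / 2) • u) = 0 := by
      simp [huu, huw, hwu]
      field_simp
      ring
    obtain ⟨τ, hτ, hτv⟩ := exists_hyperbolic_scaling hB huu hw'w' (by simp [huu, huw])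
      (c := (c - 1) / c) (div_ne_zero (sub_ne_zero.mpr hc1) hc0)
    refine ⟨τ, hτ, fun h hh => ?_, ?_⟩
    · rw [hτv]
      simp [hH h hh, hw, hfK h (Submodule.mem_sup_left hh)]
    · have hxw : B x w = c := by
        rw [hw, ← hkz, map_add, hfK _ hk, map_smul, hfu]; simp
      have hcc : ((c - 1) / c - 1) * c = -1 := by field_simp; ring
      rw [hτv]
      simp [hxu, hxw, hcc, ← sub_eq_add_neg]
  · obtain ⟨f, hfx, hfK⟩ := exists_functional_eq_one_of_notMem hx
    obtain ⟨w, hw⟩ := exists_apply_eq_of_ker_le (f := f) hB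
      fun v hv => hfK v (Submodule.mem_sup_left (Submodule.mem_sup_right hv))
    have huw : B u w = 0 := by
      rw [hw, hfK _ (Submodule.mem_sup_right (Submodule.mem_span_singleton_self _))]
    obtain ⟨τ, hτ, hτv⟩ := exists_eichler hchar hB huu huw
    refine ⟨τ, hτ, fun h hh => ?_, ?_⟩
    · rw [hτv]
      simp [hH h hh, hw, hfK h (Submodule.mem_sup_left (Submodule.mem_sup_left hh))]
    · rw [hτv]
      simp [hxu, hw, hfx]

/-- An isometry of `H + Fx` onto `H + Fy` fixing `H` and carrying `x` to `y` extends to the whole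
space, provided it is compatible with the radical. -/
theorem exists_isometry_fixing [FiniteDimensional F V] (hchar : (2 : F) ≠ 0)
    {B : LinearMap.BilinForm F V} (hB : ∀ u v : V, B u v = B v u) {H : Submodule F V} {x y : V}
    (hx : x ∉ H) (hy : y ∉ H)
    (hrad : ∀ h ∈ H, x - h ∈ LinearMap.ker B ↔ y - h ∈ LinearMap.ker B)
    (hH : ∀ h ∈ H, B h x = B h y) (hxy : B x x = B y y) :
    ∃ τ : V ≃ₗ[F] V, IsIsometry B B τ ∧ (∀ h ∈ H, τ h = h) ∧ τ x = y := by
  have hHu : ∀ h ∈ H, B h (x - y) = 0 := fun h hh => by rw [map_sub, hH h hh, sub_self]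
  have hxu : 2 * B x (x - y) = B (x - y) (x - y) := by
    simp [hB y x, ← hxy]
    ring
  by_cases huu : B (x - y) (x - y) = 0
  · by_cases hu : x - y ∈ LinearMap.ker B
    · exact exists_isometry_fixing_of_sub_mem_ker hB hx hy hu
    · refine exists_isometry_fixing_of_isotropic hchar hB hrad hHu ?_ huu hu
      rw [huu] at hxu
      exact (mul_eq_zero.mp hxu).resolve_left hchar
  · obtain ⟨τ, hτ, hτv⟩ := exists_reflection hB huu
    refine ⟨τ, hτ, fun h hh => ?_, ?_⟩
    · rw [hτv, hHu h hh]
      simp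
    · rw [hτv, hxu, div_self huu, one_smul, sub_sub_cancel]

theorem IsIsometry.mem_ker_iff {V' : Type*} [AddCommGroup V'] [Module F V']
    {B : LinearMap.BilinForm F V} {B' : LinearMap.BilinForm F V'} {ψ : V ≃ₗ[F] V'}
    (hψ : IsIsometry B B' ψ) (v : V) : ψ v ∈ LinearMap.ker B' ↔ v ∈ LinearMap.ker B := by
  simp only [LinearMap.mem_ker, LinearMap.ext_iff, LinearMap.zero_apply]
  exact ⟨fun h w => by rw [← hψ, h], fun h w => by rw [← ψ.apply_symm_apply w, hψ, h]⟩

theorem IsIsometry.symm {V' : Type*} [AddCommGroup V'] [Module F V']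
    {B : LinearMap.BilinForm F V} {B' : LinearMap.BilinForm F V'} {ψ : V ≃ₗ[F] V'}
    (hψ : IsIsometry B B' ψ) : IsIsometry B' B ψ.symm := fun u v => by
  rw [← hψ, ψ.apply_symm_apply, ψ.apply_symm_apply]

/-- Witt's extension theorem inside one possibly singular space. -/
theorem exists_isometry_extending [FiniteDimensional F V] (hchar : (2 : F) ≠ 0)
    {B : LinearMap.BilinForm F V} (hB : ∀ u v : V, B u v = B v u) (s : Finset V)
    (φ : V →ₗ[F] V)
    (hφ : ∀ u ∈ Submodule.span F (s : Set V), ∀ v ∈ Submodule.span F (s : Set V),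
      B (φ u) (φ v) = B u v)
    (hinj : ∀ v ∈ Submodule.span F (s : Set V), φ v = 0 → v = 0)
    (hrad : ∀ v ∈ Submodule.span F (s : Set V),
      φ v ∈ LinearMap.ker B ↔ v ∈ LinearMap.ker B) :
    ∃ τ : V ≃ₗ[F] V, IsIsometry B B τ ∧ ∀ v ∈ Submodule.span F (s : Set V), τ v = φ v := by
  classical
  induction s using Finset.induction_on with
  | empty => exact ⟨LinearEquiv.refl F V, fun _ _ => rfl, by simp⟩
  | insert x s _ ih =>
    rw [Finset.coe_insert] at *
    set H := Submodule.span F (s : Set V)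
    have hle : H ≤ Submodule.span F (insert x (s : Set V)) :=
      Submodule.span_mono (Set.subset_insert _ _)
    have hx_mem : x ∈ Submodule.span F (insert x (s : Set V)) :=
      Submodule.subset_span (Set.mem_insert _ _)
    obtain ⟨σ, hσ, hσφ⟩ := ih (fun u hu v hv => hφ u (hle hu) v (hle hv))
      (fun v hv => hinj v (hle hv)) (fun v hv => hrad v (hle hv))
    by_cases hx : x ∈ H
    · refine ⟨σ, hσ, fun v hv => hσφ v ?_⟩
      rwa [Submodule.span_insert_eq_span hx] at hv
    have hσy : σ (σ.symm (φ x)) = φ x := σ.apply_symm_apply _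
    have hsub : ∀ h ∈ H, σ (σ.symm (φ x) - h) = φ (x - h) := fun h hh => by
      rw [map_sub, hσy, hσφ h hh, map_sub]
    have hsub_mem : ∀ h ∈ H, x - h ∈ Submodule.span F (insert x (s : Set V)) :=
      fun h hh => Submodule.sub_mem _ hx_mem (hle hh)
    obtain ⟨τ, hτ, hτH, hτx⟩ := exists_isometry_fixing (y := σ.symm (φ x)) hchar hB hx
      (fun hy => hx <| by
        have h0 := hsub _ hy
        rw [sub_self, map_zero] at h0
        rw [sub_eq_zero.mp (hinj _ (hsub_mem _ hy) h0.symm)]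
        exact hy)
      (fun h hh => by
        rw [← hσ.mem_ker_iff (σ.symm (φ x) - h), hsub h hh, hrad _ (hsub_mem h hh)])
      (fun h hh => by rw [← hσ h (σ.symm _), hσy, hσφ h hh, hφ h (hle hh) x hx_mem])
      (by rw [← hσ (σ.symm _), hσy, hφ x hx_mem x hx_mem])
    refine ⟨τ.trans σ, fun u v => by simp [hσ _ _, hτ _ _], fun v hv => ?_⟩
    obtain ⟨a, h, hh, rfl⟩ := Submodule.mem_span_insert.mp hv
    simp [hτx, hτH h hh, hσφ h hh]

end Extension

theorem mem_orthogonal_top_iff {F V : Type*} [Field F] [AddCommGroup V] [Module F V]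
    {B : LinearMap.BilinForm F V} (hB : ∀ u v : V, B u v = B v u) (v : V) :
    v ∈ B.orthogonal ⊤ ↔ v ∈ LinearMap.ker B := by
  simp only [LinearMap.BilinForm.mem_orthogonal_iff, Submodule.mem_top, forall_const,
    LinearMap.mem_ker, LinearMap.ext_iff, LinearMap.zero_apply, hB _ v]

end Witt

/-- Lemma 2.3 (extension of Witt's theorem to possibly singular spaces):
every isometry `φ : E → E'` with `φ(E ∩ V^⊥) = E' ∩ V'^⊥` extends to an
isometry from `V` to `V'`. -/
theorem witt_extension_singular {F V V' : Type*} [Field F]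
    [AddCommGroup V] [Module F V] [AddCommGroup V'] [Module F V']
    [FiniteDimensional F V] [FiniteDimensional F V']
    (hchar : (2 : F) ≠ 0)
    (B : LinearMap.BilinForm F V) (B' : LinearMap.BilinForm F V')
    (hB : ∀ u v : V, B u v = B v u) (hB' : ∀ u v : V', B' u v = B' v u)
    (hVV' : AreIsometric B B')
    (E : Submodule F V) (E' : Submodule F V') (φ : E ≃ₗ[F] E')
    (hφ : IsIsometryOn B B' E E' φ)
    (hrad : ∀ e : E, (e : V) ∈ B.orthogonal ⊤ ↔ (φ e : V') ∈ B'.orthogonal ⊤) :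
    ∃ φV : V ≃ₗ[F] V', IsIsometry B B' φV ∧ ∀ e : E, φV (e : V) = (φ e : V') := by
  obtain ⟨ψ, hψ⟩ := hVV'
  obtain ⟨χ, hχ⟩ := LinearMap.exists_extend (ψ.symm.toLinearMap ∘ₗ E'.subtype ∘ₗ φ.toLinearMap)
  have hχE : ∀ e : E, χ e = ψ.symm (φ e) := fun e => LinearMap.congr_fun hχ e
  obtain ⟨s, rfl⟩ : E.FG := IsNoetherian.noetherian E
  obtain ⟨τ, hτ, hτχ⟩ := exists_isometry_extending hchar hB s χ
    (fun u hu v hv => by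
      rw [hχE ⟨u, hu⟩, hχE ⟨v, hv⟩, hψ.symm, hφ])
    (fun v hv h => by
      rw [hχE ⟨v, hv⟩] at h
      simpa using h)
    (fun v hv => by
      rw [hχE ⟨v, hv⟩, hψ.symm.mem_ker_iff, ← mem_orthogonal_top_iff hB', ← hrad,
        mem_orthogonal_top_iff hB])
  refine ⟨τ.trans ψ, fun u v => by simp [hψ _ _, hτ _ _], fun e => ?_⟩
  simp [hτχ e e.2, hχE]
end

section
/- Let (V,b) ≈ (V',b') be nonsingular finite-dimensional metric spaces over F, and let 𝒱 = {V_i}_{i=0,…,k} and 𝒱' = {V_i'}_{i=0,…,k} be isometric self-dual flags of V and V' respectively. Then an isometry φ : E → E' between subspaces E ⊆ V and E' ⊆ V' can be extended to an isometry φ_V : V → V' satisfying φ_V(V_i) = V_i' for all i = 0,…,k if and only if φ(E ∩ V_i) = E' ∩ V_i' for all i = 0,…,k. -/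
open Module

open Module Witt

namespace Witt

section Pairing

variable {F V V' M : Type*} [Field F] [AddCommGroup V] [Module F V]
  [AddCommGroup V'] [Module F V'] [AddCommGroup M] [Module F M]

/-- A functional on `M` is represented by a vector of `U` as soon as it vanishes on all elements
whose image under `g` is orthogonal to `U`. -/
theorem exists_mem_pairing_eq [FiniteDimensional F M] (B : LinearMap.BilinForm F V) (g : M →ₗ[F] V)
    (U : Submodule F V) (l : Dual F M)
    (h : ∀ m, (∀ w ∈ U, B w (g m) = 0) → l m = 0) :
    ∃ w ∈ U, ∀ m, B w (g m) = l m := by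
  have hl : l ∈ U.map (g.dualMap ∘ₗ B) := by
    have hU : (U.map (g.dualMap ∘ₗ B)).dualCoannihilator.dualAnnihilator =
        U.map (g.dualMap ∘ₗ B) := Subspace.dualCoannihilator_dualAnnihilator_eq
    rw [← hU, Submodule.mem_dualAnnihilator]
    intro m hm
    rw [Submodule.mem_dualCoannihilator] at hm
    exact h m fun w hw => hm _ (Submodule.mem_map_of_mem hw)
  obtain ⟨w, hw, rfl⟩ := hl
  exact ⟨w, hw, fun m => rfl⟩

theorem finrank_map_add_finrank_inf_ker [FiniteDimensional F V] (T : V →ₗ[F] M)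
    (U : Submodule F V) :
    finrank F (U.map T) + finrank F (U ⊓ LinearMap.ker T : Submodule F V) = finrank F U := by
  have h := LinearMap.finrank_range_add_finrank_ker (T.domRestrict U)
  rw [LinearMap.range_domRestrict, LinearMap.ker_domRestrict, ← Submodule.finrank_map_subtype_eq,
    Submodule.map_comap_subtype] at h
  exact h

/-- If `U` and `U'` have the same orthogonal complement in `M` and the same dimension, then the
parts of `U` and `U'` orthogonal to `M` have the same dimension. -/
theorem finrank_inf_ker_eq [FiniteDimensional F M] [FiniteDimensional F V]
    [FiniteDimensional F V']
    (B : LinearMap.BilinForm F V) (B' : LinearMap.BilinForm F V')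
    (f : M →ₗ[F] V) (g : M →ₗ[F] V') (U : Submodule F V) (U' : Submodule F V')
    (hW : finrank F U = finrank F U')
    (h : ∀ m, (∀ w ∈ U, B w (f m) = 0) ↔ (∀ w ∈ U', B' w (g m) = 0)) :
    finrank F (U ⊓ LinearMap.ker (f.dualMap ∘ₗ B) : Submodule F V) =
      finrank F (U' ⊓ LinearMap.ker (g.dualMap ∘ₗ B') : Submodule F V') := by
  have hmap : U.map (f.dualMap ∘ₗ B) = U'.map (g.dualMap ∘ₗ B') := by
    apply le_antisymm
    · rintro _ ⟨w, hw, rfl⟩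
      obtain ⟨w', hw', e⟩ := exists_mem_pairing_eq B' g U' ((f.dualMap ∘ₗ B) w)
        fun m hm => (h m).2 hm w hw
      exact ⟨w', hw', LinearMap.ext e⟩
    · rintro _ ⟨w, hw, rfl⟩
      obtain ⟨w', hw', e⟩ := exists_mem_pairing_eq B f U ((g.dualMap ∘ₗ B') w)
        fun m hm => (h m).1 hm w hw
      exact ⟨w', hw', LinearMap.ext e⟩
  have h1 := finrank_map_add_finrank_inf_ker (f.dualMap ∘ₗ B) U
  have h2 := finrank_map_add_finrank_inf_ker (g.dualMap ∘ₗ B') U'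
  rw [hmap] at h1
  omega

theorem le_range_of_finrank_eq [FiniteDimensional F V']
    {f : M →ₗ[F] V} {g : M →ₗ[F] V'} (hf : Function.Injective f) (hg : Function.Injective g)
    {S : Submodule F V} {S' : Submodule F V'} (hS : finrank F S = finrank F S')
    (h : ∀ m, f m ∈ S ↔ g m ∈ S') (hr : S ≤ LinearMap.range f) : S' ≤ LinearMap.range g := by
  have h1 : (S.comap f).map f = S := by
    rw [Submodule.map_comap_eq, inf_eq_right.2 hr]
  have h2 : S.comap f = S'.comap g := Submodule.ext h
  have h3 : (S'.comap g).map g = S' := by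
    apply Submodule.eq_of_le_of_finrank_eq (Submodule.map_comap_le g S')
    rw [← hS, ← h1, ← h2, ← (Submodule.equivMapOfInjective g hg _).finrank_eq,
      ← (Submodule.equivMapOfInjective f hf _).finrank_eq]
  rw [← h3]
  exact LinearMap.map_le_range

end Pairing

section Reflection

variable {F V : Type*} [Field F] [AddCommGroup V] [Module F V]

theorem exists_isometry_reflection {B : LinearMap.BilinForm F V}
    (hB : ∀ u v, B u v = B v u) {w : V} (hw : B w w ≠ 0) :
    ∃ σ : V ≃ₗ[F] V, IsIsometry B B σ ∧ ∀ v, σ v = v - (2 * B w v / B w w) • w := by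
  have hf : ((2 / B w w) • B w) w = 2 := by
    simp [hw]
  refine ⟨Module.reflection hf, ?_, ?_⟩
  · intro u v
    simp only [Module.reflection_apply, LinearMap.smul_apply, map_sub, LinearMap.sub_apply,
      map_smul, smul_eq_mul]
    rw [hB u w]
    field_simp
    ring
  · intro v
    rw [Module.reflection_apply]
    congr 2
    simp only [LinearMap.smul_apply, smul_eq_mul]
    ring

theorem exists_isometry_map_eq (hchar : (2 : F) ≠ 0) {B : LinearMap.BilinForm F V}
    (hB : ∀ u v, B u v = B v u) {x y : V} (hx : B x x ≠ 0) (hxy : B y y = B x x) :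
    ∃ σ : V ≃ₗ[F] V, IsIsometry B B σ ∧ σ x = y ∧ ∀ z, B x z = 0 → B y z = 0 → σ z = z := by
  by_cases h : B (x - y) (x - y) = 0
  · have hs : B (x + y) (x + y) = 4 * B x x := by
      simp only [map_sub, map_add, LinearMap.sub_apply, LinearMap.add_apply, hB y x, hxy] at h ⊢
      linear_combination -h
    have h4 : (4 : F) ≠ 0 := by
      have : (4 : F) = 2 * 2 := by norm_num
      rw [this]; exact mul_ne_zero hchar hchar
    have hs0 : B (x + y) (x + y) ≠ 0 := by rw [hs]; exact mul_ne_zero h4 hx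
    have hy : B y y ≠ 0 := by rwa [hxy]
    obtain ⟨σ, hσ, hσ'⟩ := exists_isometry_reflection hB hs0
    obtain ⟨τ, hτ, hτ'⟩ := exists_isometry_reflection hB hy
    refine ⟨σ.trans τ, fun u v => (hτ _ _).trans (hσ u v), ?_, fun z hz hz' => ?_⟩
    · have e : 2 * B (x + y) x / B (x + y) (x + y) = 1 := by
        rw [div_eq_one_iff_eq hs0]
        simp only [map_add, LinearMap.add_apply, hB y x, hxy]
        ring
      have e' : σ x = -y := by rw [hσ', e]; module
      rw [LinearEquiv.trans_apply, e', map_neg, hτ', mul_div_assoc, div_self hy]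
      module
    · rw [LinearEquiv.trans_apply, hσ', hτ']
      simp [hz, hz']
  · obtain ⟨σ, hσ, hσ'⟩ := exists_isometry_reflection hB h
    refine ⟨σ, hσ, ?_, fun z hz hz' => by rw [hσ']; simp [hz, hz']⟩
    have e : 2 * B (x - y) x / B (x - y) (x - y) = 1 := by
      rw [div_eq_one_iff_eq h]
      simp only [map_sub, LinearMap.sub_apply, hB y x, hxy]
      ring
    rw [hσ', e]
    module

/-- Isometric spaces admit an isometry carrying a given orthogonal family of anisotropic vectors
to another one with the same norms. -/
theorem exists_isometry_of_orthogonal_family {V' : Type*} [AddCommGroup V'] [Module F V']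
    (hchar : (2 : F) ≠ 0) {B : LinearMap.BilinForm F V} {B' : LinearMap.BilinForm F V'}
    (hB' : ∀ u v, B' u v = B' v u) (hiso : AreIsometric B B') {ι : Type*} (s : Finset ι)
    (v : ι → V) (v' : ι → V') (hne : ∀ i, B (v i) (v i) ≠ 0)
    (hort : ∀ i j, i ≠ j → B (v i) (v j) = 0) (heq : ∀ i j, B' (v' i) (v' j) = B (v i) (v j)) :
    ∃ g : V ≃ₗ[F] V', IsIsometry B B' g ∧ ∀ i ∈ s, g (v i) = v' i := by
  classical
  induction s using Finset.induction_on with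
  | empty =>
    obtain ⟨g, hg⟩ := hiso
    exact ⟨g, hg, by simp⟩
  | insert a s ha ih =>
    obtain ⟨g, hg, hgs⟩ := ih
    obtain ⟨σ, hσ, hσa, hσs⟩ := exists_isometry_map_eq hchar hB' (x := g (v a)) (y := v' a)
      (by rw [hg]; exact hne a) (by rw [hg, heq])
    refine ⟨g.trans σ, fun u w => (hσ _ _).trans (hg u w), fun i hi => ?_⟩
    rw [LinearEquiv.trans_apply]
    rcases Finset.mem_insert.1 hi with rfl | hi
    · exact hσa
    · have hai : a ≠ i := fun h => ha (h ▸ hi)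
      rw [hgs i hi]
      apply hσs
      · rw [← hgs i hi, hg, hort a i hai]
      · rw [heq, hort a i hai]

end Reflection

section Graph

variable {F V V' : Type*} [Field F] [AddCommGroup V] [Module F V]
  [AddCommGroup V'] [Module F V']

/-- A linear relation between `V` and `V'` is isometric if related vectors have the same
inner products. -/
def IsometricGraph (B : LinearMap.BilinForm F V) (B' : LinearMap.BilinForm F V')
    (G : Submodule F (V × V')) : Prop :=
  ∀ p ∈ G, ∀ q ∈ G, B' p.2 q.2 = B p.1 q.1

/-- A linear relation between `V` and `V'` is compatible with the subspaces `S` and `S'` if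
a vector lies in `S` exactly when the vectors related to it lie in `S'`. -/
def Compatible (S : Submodule F V) (S' : Submodule F V') (G : Submodule F (V × V')) : Prop :=
  ∀ p ∈ G, p.1 ∈ S ↔ p.2 ∈ S'

variable {B : LinearMap.BilinForm F V} {B' : LinearMap.BilinForm F V'}
  {G : Submodule F (V × V')}

theorem forall_mem_sup_span_singleton {P : V × V' → Prop} {a : V × V'}
    (h : ∀ p ∈ G, ∀ c : F, P (p + c • a)) : ∀ p ∈ G ⊔ Submodule.span F {a}, P p := by
  intro p hp
  obtain ⟨q, hq, r, hr, rfl⟩ := Submodule.mem_sup.1 hp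
  obtain ⟨c, rfl⟩ := Submodule.mem_span_singleton.1 hr
  exact h q hq c

theorem IsometricGraph.sup_span_singleton (hB : ∀ u v, B u v = B v u)
    (hB' : ∀ u v, B' u v = B' v u) (hG : IsometricGraph B B' G) {x : V} {x' : V'}
    (hx : ∀ p ∈ G, B' x' p.2 = B x p.1) (hxx : B' x' x' = B x x) :
    IsometricGraph B B' (G ⊔ Submodule.span F {(x, x')}) := by
  refine forall_mem_sup_span_singleton fun p hp c =>
    forall_mem_sup_span_singleton fun q hq d => ?_
  simp only [Prod.fst_add, Prod.snd_add, Prod.smul_fst, Prod.smul_snd, map_add, map_smul,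
    LinearMap.add_apply, LinearMap.smul_apply, smul_eq_mul]
  rw [hG p hp q hq, hB' p.2 x', hB p.1 x, hx p hp, hx q hq, hxx]

theorem Compatible.injective_fst (hG : Compatible (⊥ : Submodule F V) (⊥ : Submodule F V') G) :
    Function.Injective (LinearMap.fst F V V' ∘ₗ G.subtype) := by
  rw [injective_iff_map_eq_zero]
  rintro ⟨p, hp⟩ (h : p.1 = 0)
  exact Subtype.ext (Prod.ext h ((hG p hp).1 h))

theorem Compatible.injective_snd (hG : Compatible (⊥ : Submodule F V) (⊥ : Submodule F V') G) :
    Function.Injective (LinearMap.snd F V V' ∘ₗ G.subtype) := by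
  rw [injective_iff_map_eq_zero]
  rintro ⟨p, hp⟩ (h : p.2 = 0)
  exact Subtype.ext (Prod.ext ((hG p hp).2 h) h)

theorem mem_of_maximal_sup_span {P : Submodule F (V × V') → Prop} (hG : Maximal P G) {a : V × V'}
    (h : P (G ⊔ Submodule.span F {a})) : a ∈ G :=
  hG.le_of_ge h le_sup_left (Submodule.mem_sup_right (Submodule.mem_span_singleton_self a))

/-- A maximal isometric injective relation has nonsingular domain. -/
theorem eq_zero_of_maximal_isometricGraph [FiniteDimensional F V] [FiniteDimensional F V']
    (hchar : (2 : F) ≠ 0)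
    (hB : ∀ u v, B u v = B v u) (hB' : ∀ u v, B' u v = B' v u)
    (hnd : B.Nondegenerate) (hnd' : B'.Nondegenerate)
    (hG : Maximal (fun G => IsometricGraph B B' G ∧ Compatible ⊥ ⊥ G) G)
    {p : V × V'} (hp : p ∈ G) (hrad : ∀ q ∈ G, B p.1 q.1 = 0) : p = 0 := by
  obtain ⟨hiso, hinj⟩ := hG.prop
  by_contra hp0
  have hp1 : p.1 ≠ 0 := fun h => hp0 (Prod.ext h ((hinj p hp).1 h))
  obtain ⟨z, hz⟩ : ∃ z, B p.1 z ≠ 0 := by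
    by_contra! h
    exact hp1 (hnd.1 _ h)
  obtain ⟨z', -, hz'⟩ := exists_mem_pairing_eq B' (LinearMap.snd F V V' ∘ₗ G.subtype) ⊤
    (B z ∘ₗ LinearMap.fst F V V' ∘ₗ G.subtype) (fun m hm => by
      have h1 : (m : V × V').2 = 0 := hnd'.2 _ fun w => hm w trivial
      have h2 : (m : V × V').1 = 0 := (hinj m m.2).2 h1
      simp [h2])
  replace hz' : ∀ q ∈ G, B' z' q.2 = B z q.1 := fun q hq => hz' ⟨q, hq⟩
  have hzp : B z p.1 ≠ 0 := by rwa [hB]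
  have hmatch : ∀ t : F, ∀ q ∈ G, B' (z' + t • p.2) q.2 = B z q.1 := fun t q hq => by
    simp [hz' q hq, hiso p hp q hq, hrad q hq]
  have hnorm : B' (z' + ((B z z - B' z' z') / (2 * B z p.1)) • p.2)
      (z' + ((B z z - B' z' z') / (2 * B z p.1)) • p.2) = B z z := by
    simp only [map_add, map_smul, LinearMap.add_apply, LinearMap.smul_apply, smul_eq_mul,
      hB' p.2 z', hz' p hp, hiso p hp p hp, hrad p hp]
    field_simp
    ring
  have hmem := mem_of_maximal_sup_span hG ⟨hiso.sup_span_singleton hB hB' (hmatch _) hnorm, by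
    refine forall_mem_sup_span_singleton fun q hq c => ?_
    simp only [Prod.fst_add, Prod.snd_add, Prod.smul_fst, Prod.smul_snd, Submodule.mem_bot]
    constructor
    · intro h
      have hc : c = 0 := by
        have := congrArg (B p.1) h
        simpa [hrad q hq, hz] using this
      subst hc
      simpa using (hinj q hq).1 (by simpa using h)
    · intro h
      have hc : c = 0 := by
        have := congrArg (B' p.2) h
        simpa [hiso p hp q hq, hiso p hp p hp, hrad p hp, hrad q hq, hB' p.2 z', hz' p hp,
          hzp] using this
      subst hc
      simpa using (hinj q hq).2 (by simpa using h)⟩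
  exact hz (hrad _ hmem)

/-- **Witt's extension theorem** for isometric injective relations. -/
theorem exists_isometry_of_isometricGraph [FiniteDimensional F V] [FiniteDimensional F V']
    (hchar : (2 : F) ≠ 0)
    (hB : ∀ u v, B u v = B v u) (hB' : ∀ u v, B' u v = B' v u)
    (hnd : B.Nondegenerate) (hnd' : B'.Nondegenerate) (hiso : AreIsometric B B')
    (hG : IsometricGraph B B' G) (hG0 : Compatible ⊥ ⊥ G) :
    ∃ g : V ≃ₗ[F] V', IsIsometry B B' g ∧ ∀ p ∈ G, g p.1 = p.2 := by
  obtain ⟨H, hGH, hH⟩ := exists_maximal_ge_of_wellFoundedGT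
    (fun G => IsometricGraph B B' G ∧ Compatible ⊥ ⊥ G) G ⟨hG, hG0⟩
  set f := LinearMap.fst F V V' ∘ₗ H.subtype
  let _ : Invertible (2 : F) := invertibleOfNonzero hchar
  obtain ⟨b, hb⟩ := LinearMap.BilinForm.exists_orthogonal_basis (B := B.compl₁₂ f f)
    ⟨fun u v => hB _ _⟩
  have hne : ∀ i, B (b i : V × V').1 (b i : V × V').1 ≠ 0 := by
    intro i hi
    have hrad : B.compl₁₂ f f (b i) = 0 := b.ext fun j => by
      rcases eq_or_ne i j with rfl | hij
      · exact hi
      · exact hb hij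
    exact b.ne_zero i (Subtype.ext (eq_zero_of_maximal_isometricGraph hchar hB hB' hnd hnd' hH
      (b i).2 fun q hq => LinearMap.congr_fun hrad ⟨q, hq⟩))
  obtain ⟨g, hg, hgb⟩ := exists_isometry_of_orthogonal_family hchar hB' hiso Finset.univ
    (fun i => (b i : V × V').1) (fun i => (b i : V × V').2) hne (fun i j hij => hb hij)
    (fun i j => hH.prop.1 _ (b i).2 _ (b j).2)
  refine ⟨g, hg, fun p hp => ?_⟩
  have : g.toLinearMap ∘ₗ f = LinearMap.snd F V V' ∘ₗ H.subtype :=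
    b.ext fun i => hgb i (Finset.mem_univ i)
  exact LinearMap.congr_fun this ⟨p, hGH hp⟩

/-- If `U` is not contained in the domain of a compatible isometric relation, then some vector of
`U'` outside the range represents the functional given by a vector of `U` outside the domain. -/
theorem exists_match_notMem_range [FiniteDimensional F V] [FiniteDimensional F V']
    (hG : IsometricGraph B B' G) (hG0 : Compatible ⊥ ⊥ G)
    {U : Submodule F V} {U' : Submodule F V'} (hWG : Compatible U U' G)
    (hWB : Compatible (B.orthogonal U) (B'.orthogonal U') G) (hW : finrank F U = finrank F U')
    {x : V} (hxW : x ∈ U) (hx : x ∉ LinearMap.range (LinearMap.fst F V V' ∘ₗ G.subtype)) :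
    ∃ x' ∈ U', x' ∉ LinearMap.range (LinearMap.snd F V V' ∘ₗ G.subtype) ∧
      ∀ p ∈ G, B' x' p.2 = B x p.1 := by
  set f := LinearMap.fst F V V' ∘ₗ G.subtype with hf
  set g := LinearMap.snd F V V' ∘ₗ G.subtype with hg
  have hperp : ∀ m : G, (∀ w ∈ U, B w (f m) = 0) ↔ (∀ w ∈ U', B' w (g m) = 0) := fun m => by
    rw [← LinearMap.BilinForm.mem_orthogonal_iff, ← LinearMap.BilinForm.mem_orthogonal_iff]
    exact hWB m m.2
  obtain ⟨x', hx'U, hx'⟩ := exists_mem_pairing_eq B' g U' (B x ∘ₗ f)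
    fun m hm => (hperp m).2 hm x hxW
  by_cases hx'r : x' ∈ LinearMap.range g
  · obtain ⟨z, rfl⟩ := hx'r
    have hzW : f z ∈ U := (hWG z z.2).2 hx'U
    have hK : ¬ U' ⊓ LinearMap.ker (g.dualMap ∘ₗ B') ≤ LinearMap.range g := by
      intro hle
      have hle' : U ⊓ LinearMap.ker (f.dualMap ∘ₗ B) ≤ LinearMap.range f := by
        refine le_range_of_finrank_eq hG0.injective_snd hG0.injective_fst
          (finrank_inf_ker_eq B B' f g U U' hW hperp).symm (fun m => ?_) hle
        refine and_congr (hWG m m.2).symm ?_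
        simp only [SetLike.mem_coe, LinearMap.mem_ker, LinearMap.ext_iff]
        refine forall_congr' fun n => ?_
        change B' (m : V × V').2 (n : V × V').2 = 0 ↔ B (m : V × V').1 (n : V × V').1 = 0
        rw [hG m m.2 n n.2]
      have hxz : x - f z ∈ LinearMap.range f := by
        refine hle' ⟨sub_mem hxW hzW, ?_⟩
        rw [SetLike.mem_coe, LinearMap.mem_ker]
        ext n
        have h1 : B' (g z) (g n) = B x (f n) := hx' n
        have h2 : B' (g z) (g n) = B (f z) (f n) := hG z z.2 n n.2
        change B (x - f z) (f n) = 0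
        rw [map_sub, LinearMap.sub_apply, ← h1, h2, sub_self]
      exact hx (by simpa using add_mem hxz (LinearMap.mem_range_self f z))
    obtain ⟨u, ⟨huW, hu⟩, hur⟩ := Set.not_subset.1 hK
    refine ⟨g z + u, add_mem hx'U huW, fun h => hur ?_, fun p hp => ?_⟩
    · simpa using sub_mem h (LinearMap.mem_range_self g z)
    · have h1 : B' (g z) p.2 = B x p.1 := hx' ⟨p, hp⟩
      have h2 : B' u p.2 = 0 := LinearMap.congr_fun (LinearMap.mem_ker.1 hu) ⟨p, hp⟩
      rw [map_add, LinearMap.add_apply, h1, h2, add_zero]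
  · exact ⟨x', hx'U, hx'r, fun p hp => hx' ⟨p, hp⟩⟩

theorem add_smul_notMem {S E : Submodule F V} {e x : V} {c : F} (hc : c ≠ 0) (he : e ∈ E)
    (hx : x ∉ E) (hS : S ≤ E) : e + c • x ∉ S := fun h =>
  hx ((E.smul_mem_iff hc).1 (by simpa using sub_mem (hS h) he))

end Graph

section Flag

variable {F V V' : Type*} [Field F] [AddCommGroup V] [Module F V]
  [AddCommGroup V'] [Module F V'] [FiniteDimensional F V] [FiniteDimensional F V']
  {B : LinearMap.BilinForm F V} {B' : LinearMap.BilinForm F V'} {G : Submodule F (V × V')}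
  {k : ℕ} {𝒱 : ℕ → Submodule F V} {𝒱' : ℕ → Submodule F V'}

/-- The domain of a maximal isometric relation compatible with two self-dual flags contains the
totally isotropic half of the first flag. -/
theorem le_range_fst_of_maximal (hB : ∀ u v, B u v = B v u) (hB' : ∀ u v, B' u v = B' v u)
    (h0 : 𝒱 0 = ⊥) (hmono : ∀ i < k, 𝒱 i ≤ 𝒱 (i + 1))
    (h0' : 𝒱' 0 = ⊥) (hmono' : ∀ i < k, 𝒱' i ≤ 𝒱' (i + 1))
    (hsd : ∀ i ≤ k, B.orthogonal (𝒱 i) = 𝒱 (k - i))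
    (hsd' : ∀ i ≤ k, B'.orthogonal (𝒱' i) = 𝒱' (k - i))
    (hrank : ∀ i ≤ k, finrank F (𝒱 i) = finrank F (𝒱' i))
    (hG : Maximal (fun G => IsometricGraph B B' G ∧ ∀ i ≤ k, Compatible (𝒱 i) (𝒱' i) G) G)
    {i : ℕ} (hi : 2 * i ≤ k) : 𝒱 i ≤ LinearMap.range (LinearMap.fst F V V' ∘ₗ G.subtype) := by
  obtain ⟨hiso, hcomp⟩ := hG.prop
  have hinj : Compatible (⊥ : Submodule F V) (⊥ : Submodule F V') G := by
    simpa [h0, h0'] using hcomp 0 (Nat.zero_le k)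
  have mono : ∀ i j, i ≤ j → j ≤ k → 𝒱 i ≤ 𝒱 j := fun i j hij =>
    Nat.le_induction (fun _ => le_rfl) (fun n _ ih h => (ih (by omega)).trans (hmono n h)) j hij
  have mono' : ∀ i j, i ≤ j → j ≤ k → 𝒱' i ≤ 𝒱' j := fun i j hij =>
    Nat.le_induction (fun _ => le_rfl) (fun n _ ih h => (ih (by omega)).trans (hmono' n h)) j hij
  induction i with
  | zero => simp [h0]
  | succ i ih =>
    specialize ih (by omega)
    have ih' := le_range_of_finrank_eq hinj.injective_fst hinj.injective_snd
      (hrank i (by omega)) (fun m => hcomp i (by omega) m m.2) ih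
    by_contra hnot
    obtain ⟨x, hxi, hx⟩ := Set.not_subset.1 hnot
    obtain ⟨x', hxi', hx', hmatch⟩ := exists_match_notMem_range hiso hinj
      (hcomp (i + 1) (by omega))
      (by rw [hsd _ (by omega), hsd' _ (by omega)]; exact hcomp _ (by omega))
      (hrank (i + 1) (by omega)) hxi hx
    have hxx : B x x = 0 := by
      have : x ∈ B.orthogonal (𝒱 (i + 1)) := by
        rw [hsd _ (by omega)]; exact mono _ _ (by omega) (by omega) hxi
      exact this x hxi
    have hxx' : B' x' x' = 0 := by
      have : x' ∈ B'.orthogonal (𝒱' (i + 1)) := by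
        rw [hsd' _ (by omega)]; exact mono' _ _ (by omega) (by omega) hxi'
      exact this x' hxi'
    have hmem := mem_of_maximal_sup_span (a := (x, x')) hG
      ⟨hiso.sup_span_singleton hB hB' hmatch (by rw [hxx, hxx']), fun j hj => by
        refine forall_mem_sup_span_singleton fun p hp c => ?_
        simp only [Prod.fst_add, Prod.snd_add, Prod.smul_fst, Prod.smul_snd]
        rcases eq_or_ne c 0 with rfl | hc
        · simpa using hcomp j hj p hp
        rcases Nat.lt_or_ge i j with hij | hij
        · rw [Submodule.add_mem_iff_left _ (Submodule.smul_mem _ c (mono _ _ hij hj hxi)),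
            Submodule.add_mem_iff_left _ (Submodule.smul_mem _ c (mono' _ _ hij hj hxi'))]
          exact hcomp j hj p hp
        · exact iff_of_false
            (add_smul_notMem hc (LinearMap.mem_range.2 ⟨⟨p, hp⟩, rfl⟩) hx
              ((mono _ _ hij (by omega)).trans ih))
            (add_smul_notMem hc (LinearMap.mem_range.2 ⟨⟨p, hp⟩, rfl⟩) hx'
              ((mono' _ _ hij (by omega)).trans ih'))⟩
    exact hx ⟨⟨_, hmem⟩, rfl⟩

theorem exists_flag_isometry_of_isometricGraph (hchar : (2 : F) ≠ 0)
    (hB : ∀ u v, B u v = B v u) (hB' : ∀ u v, B' u v = B' v u)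
    (hnd : B.Nondegenerate) (hnd' : B'.Nondegenerate) (hiso : AreIsometric B B')
    (h0 : 𝒱 0 = ⊥) (hmono : ∀ i < k, 𝒱 i ≤ 𝒱 (i + 1))
    (h0' : 𝒱' 0 = ⊥) (hmono' : ∀ i < k, 𝒱' i ≤ 𝒱' (i + 1))
    (hsd : ∀ i ≤ k, B.orthogonal (𝒱 i) = 𝒱 (k - i))
    (hsd' : ∀ i ≤ k, B'.orthogonal (𝒱' i) = 𝒱' (k - i))
    (hrank : ∀ i ≤ k, finrank F (𝒱 i) = finrank F (𝒱' i))
    (hG : IsometricGraph B B' G) (hcomp : ∀ i ≤ k, Compatible (𝒱 i) (𝒱' i) G) :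
    ∃ g : V ≃ₗ[F] V', IsIsometry B B' g ∧ (∀ p ∈ G, g p.1 = p.2) ∧
      ∀ i ≤ k, (𝒱 i).map g.toLinearMap = 𝒱' i := by
  obtain ⟨H, hGH, hH⟩ := exists_maximal_ge_of_wellFoundedGT
    (fun G => IsometricGraph B B' G ∧ ∀ i ≤ k, Compatible (𝒱 i) (𝒱' i) G) G ⟨hG, hcomp⟩
  obtain ⟨g, hg, hgH⟩ := exists_isometry_of_isometricGraph hchar hB hB' hnd hnd' hiso hH.prop.1
    (by simpa [h0, h0'] using hH.prop.2 0 (Nat.zero_le k))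
  have key : ∀ i ≤ k, (𝒱 i).map g.toLinearMap ≤ 𝒱' i → (𝒱 i).map g.toLinearMap = 𝒱' i :=
    fun i hi h => Submodule.eq_of_le_of_finrank_eq h
      ((LinearEquiv.finrank_map_eq g _).trans (hrank i hi))
  have low : ∀ i, 2 * i ≤ k → (𝒱 i).map g.toLinearMap = 𝒱' i := by
    refine fun i hi => key i (by omega) ?_
    rintro _ ⟨v, hv, rfl⟩
    obtain ⟨p, rfl⟩ := le_range_fst_of_maximal hB hB' h0 hmono h0' hmono' hsd hsd' hrank hH hi hv
    have hp : g (p : V × V').1 = (p : V × V').2 := hgH p p.2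
    change g (p : V × V').1 ∈ 𝒱' i
    rw [hp]
    exact (hH.prop.2 i (by omega) p p.2).1 hv
  refine ⟨g, hg, fun p hp => hgH p (hGH hp), fun i hi => ?_⟩
  rcases Nat.le_total (2 * i) k with h | h
  · exact low i h
  · have e : k - (k - i) = i := by omega
    have e1 := hsd (k - i) (by omega)
    have e2 := hsd' (k - i) (by omega)
    rw [e] at e1 e2
    apply key i hi
    rintro _ ⟨v, hv, rfl⟩
    rw [← e2, LinearMap.BilinForm.mem_orthogonal_iff, ← low (k - i) (by omega)]
    rintro _ ⟨u, hu, rfl⟩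
    rw [SetLike.mem_coe, ← e1] at hv
    exact (hg u v).trans (hv u hu)

end Flag

end Witt

/-- Theorem 3.2: an isometry `φ : E → E'` extends to an isometry `V → V'`
sending the self-dual flag `𝒱` to the self-dual flag `𝒱'` iff
`φ(E ∩ V_i) = E' ∩ V_i'` for all `i`. -/
theorem witt_extension_selfdual_flag {F V V' : Type*} [Field F]
    [AddCommGroup V] [Module F V] [AddCommGroup V'] [Module F V']
    [FiniteDimensional F V] [FiniteDimensional F V']
    (hchar : (2 : F) ≠ 0)
    (B : LinearMap.BilinForm F V) (B' : LinearMap.BilinForm F V')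
    (hB : ∀ u v : V, B u v = B v u) (hB' : ∀ u v : V', B' u v = B' v u)
    (hnd : B.Nondegenerate) (hnd' : B'.Nondegenerate)
    (k : ℕ) (𝒱 : ℕ → Submodule F V) (𝒱' : ℕ → Submodule F V')
    (h0 : 𝒱 0 = ⊥) (hk : 𝒱 k = ⊤) (hmono : ∀ i < k, 𝒱 i ≤ 𝒱 (i + 1))
    (h0' : 𝒱' 0 = ⊥) (hk' : 𝒱' k = ⊤) (hmono' : ∀ i < k, 𝒱' i ≤ 𝒱' (i + 1))
    (hsd : ∀ i ≤ k, B.orthogonal (𝒱 i) = 𝒱 (k - i))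
    (hsd' : ∀ i ≤ k, B'.orthogonal (𝒱' i) = 𝒱' (k - i))
    (hflags : ∃ ψ : V ≃ₗ[F] V', IsIsometry B B' ψ ∧
      ∀ i ≤ k, (𝒱 i).map ψ.toLinearMap = 𝒱' i)
    (E : Submodule F V) (E' : Submodule F V')
    (φ : E ≃ₗ[F] E') (hφ : IsIsometryOn B B' E E' φ) :
    (∃ φV : V ≃ₗ[F] V', IsIsometry B B' φV ∧
        (∀ e : E, φV (e : V) = (φ e : V')) ∧
        ∀ i ≤ k, (𝒱 i).map φV.toLinearMap = 𝒱' i) ↔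
      (∀ i ≤ k, ∀ e : E, (e : V) ∈ 𝒱 i ↔ (φ e : V') ∈ 𝒱' i) := by
  constructor
  · rintro ⟨g, -, hgφ, hgV⟩ i hi e
    rw [← hgV i hi, ← hgφ e]
    exact g.injective.mem_set_image.symm
  · intro h
    obtain ⟨ψ, hψ, hψV⟩ := hflags
    obtain ⟨g, hg, hgG, hgV⟩ := exists_flag_isometry_of_isometricGraph
      (G := LinearMap.range (E.subtype.prod (E'.subtype ∘ₗ φ.toLinearMap)))
      hchar hB hB' hnd hnd' ⟨ψ, hψ⟩ h0 hmono h0' hmono' hsd hsd'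
      (fun i hi => by rw [← hψV i hi]; exact (LinearEquiv.finrank_map_eq ψ _).symm)
      (by rintro _ ⟨u, rfl⟩ _ ⟨v, rfl⟩; exact hφ u v)
      (by rintro i hi _ ⟨u, rfl⟩; exact h i hi u)
    exact ⟨g, hg, fun e => hgG _ ⟨e, rfl⟩, hgV⟩
end

section
/- Let V = A ⊕ B and V' = A' ⊕ B' be direct sum decompositions of finite-dimensional vector spaces over a field such that dim A = dim A' and dim B = dim B'. Then a linear bijection φ : E → E' between subspaces E ⊆ V and E' ⊆ V' can be extended to a linear bijection φ_V : V → V' such that φ_V(A) = A' and φ_V(B) = B' if and only if φ(E ∩ A) = E' ∩ A' and φ(E ∩ B) = E' ∩ B'. -/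
open Module

open Module Witt

open Submodule in
/-- Two linear maps with the same kernel into spaces of equal finite dimension differ by a linear
equivalence of their codomains. -/
theorem LinearMap.exists_linearEquiv_apply_eq_of_ker_eq {F E U U' : Type*} [Field F]
    [AddCommGroup E] [Module F E] [AddCommGroup U] [Module F U] [AddCommGroup U'] [Module F U']
    [FiniteDimensional F U] [FiniteDimensional F U'] (hd : finrank F U = finrank F U')
    (f : E →ₗ[F] U) (g : E →ₗ[F] U') (hk : LinearMap.ker f = LinearMap.ker g) :
    ∃ e : U ≃ₗ[F] U', ∀ x, e (f x) = g x := by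
  obtain ⟨C, hC⟩ := (LinearMap.range f).exists_isCompl
  obtain ⟨C', hC'⟩ := (LinearMap.range g).exists_isCompl
  let r : LinearMap.range f ≃ₗ[F] LinearMap.range g :=
    f.quotKerEquivRange.symm ≪≫ₗ quotEquivOfEq _ _ hk ≪≫ₗ g.quotKerEquivRange
  have hr (x : E) : r (f.rangeRestrict x) = g.rangeRestrict x := by
    have hx : f.quotKerEquivRange.symm (f.rangeRestrict x) = (LinearMap.ker f).mkQ x :=
      f.quotKerEquivRange_symm_apply_image x _
    simp only [r, LinearEquiv.trans_apply, hx]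
    rfl
  have hCC : finrank F C = finrank F C' := by
    have h₁ := finrank_add_eq_of_isCompl hC
    have h₂ := finrank_add_eq_of_isCompl hC'
    have h₃ := r.finrank_eq
    omega
  refine ⟨(prodEquivOfIsCompl _ _ hC).symm ≪≫ₗ
    r.prodCongr (LinearEquiv.ofFinrankEq C C' hCC) ≪≫ₗ prodEquivOfIsCompl _ _ hC', fun x => ?_⟩
  have hx : (prodEquivOfIsCompl _ _ hC).symm (f x) = (f.rangeRestrict x, 0) :=
    prodEquivOfIsCompl_symm_apply_left _ _ hC (f.rangeRestrict x)
  simp [hx, hr]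

/-- Lemma 4.1: given direct sum decompositions `V = A ⊕ B` and `V' = A' ⊕ B'`
with `dim A = dim A'` and `dim B = dim B'`, a linear bijection `φ : E → E'`
extends to a linear bijection `V → V'` sending `A` to `A'` and `B` to `B'`
iff `φ(E ∩ A) = E' ∩ A'` and `φ(E ∩ B) = E' ∩ B'`. -/
theorem extend_linear_bijection_two_summands {F V V' : Type*} [Field F]
    [AddCommGroup V] [Module F V] [AddCommGroup V'] [Module F V']
    [FiniteDimensional F V] [FiniteDimensional F V']
    (A Bs : Submodule F V) (A' Bs' : Submodule F V')
    (hdisj : A ⊓ Bs = ⊥) (hsum : A ⊔ Bs = ⊤)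
    (hdisj' : A' ⊓ Bs' = ⊥) (hsum' : A' ⊔ Bs' = ⊤)
    (hdA : finrank F ↥A = finrank F ↥A') (hdB : finrank F ↥Bs = finrank F ↥Bs')
    (E : Submodule F V) (E' : Submodule F V') (φ : E ≃ₗ[F] E') :
    (∃ φV : V ≃ₗ[F] V', (∀ e : E, φV (e : V) = (φ e : V')) ∧
        A.map φV.toLinearMap = A' ∧ Bs.map φV.toLinearMap = Bs') ↔
      ((∀ e : E, (e : V) ∈ A ↔ (φ e : V') ∈ A') ∧
       (∀ e : E, (e : V) ∈ Bs ↔ (φ e : V') ∈ Bs')) := by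
  have hc : IsCompl A Bs := ⟨disjoint_iff.mpr hdisj, codisjoint_iff.mpr hsum⟩
  have hc' : IsCompl A' Bs' := ⟨disjoint_iff.mpr hdisj', codisjoint_iff.mpr hsum'⟩
  constructor
  · rintro ⟨ψ, hψ, rfl, rfl⟩
    constructor <;> intro e <;> rw [← hψ e] <;> simp
  · rintro ⟨hA, hB⟩
    obtain ⟨α, hα⟩ := LinearMap.exists_linearEquiv_apply_eq_of_ker_eq hdA
      (A.projectionOnto Bs hc ∘ₗ E.subtype)
      (A'.projectionOnto Bs' hc' ∘ₗ E'.subtype ∘ₗ φ.toLinearMap) (by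
        ext e
        simpa using hB e)
    obtain ⟨β, hβ⟩ := LinearMap.exists_linearEquiv_apply_eq_of_ker_eq hdB
      (Bs.projectionOnto A hc.symm ∘ₗ E.subtype)
      (Bs'.projectionOnto A' hc'.symm ∘ₗ E'.subtype ∘ₗ φ.toLinearMap) (by
        ext e
        simpa using hA e)
    let ψ : V ≃ₗ[F] V' := (Submodule.prodEquivOfIsCompl A Bs hc).symm ≪≫ₗ
      α.prodCongr β ≪≫ₗ Submodule.prodEquivOfIsCompl A' Bs' hc'
    have hψA (a : A) : ψ a = α a := by simp [ψ]
    have hψB (b : Bs) : ψ b = β b := by simp [ψ]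
    refine ⟨ψ, fun e => ?_, ?_, ?_⟩
    · have he := Submodule.projection_add_projection_eq_self hc (e : V)
      have he' := Submodule.projection_add_projection_eq_self hc' (φ e : V')
      have h₁ := hα e
      have h₂ := hβ e
      simp only [LinearMap.comp_apply, Submodule.subtype_apply, LinearEquiv.coe_coe] at h₁ h₂
      rw [← Submodule.coe_projectionOnto_apply, ← Submodule.coe_projectionOnto_apply] at he he'
      rw [← he, map_add, hψA, hψB, h₁, h₂, he']
    · refine Submodule.eq_of_le_of_finrank_eq ?_ ?_
      · rintro _ ⟨a, ha, rfl⟩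
        exact (hψA ⟨a, ha⟩).symm ▸ (α ⟨a, ha⟩).2
      · exact (LinearEquiv.finrank_map_eq ψ A).trans hdA
    · refine Submodule.eq_of_le_of_finrank_eq ?_ ?_
      · rintro _ ⟨b, hb, rfl⟩
        exact (hψB ⟨b, hb⟩).symm ▸ (β ⟨b, hb⟩).2
      · exact (LinearEquiv.finrank_map_eq ψ Bs).trans hdB
end

section
/- Let V = A ⊕ B ⊕ C and V' = A' ⊕ B' ⊕ C' be direct sum decompositions of finite-dimensional vector spaces over a field such that dim A = dim A', dim B = dim B', and dim C = dim C'. Then a linear bijection φ : E → E' between subspaces E ⊆ V and E' ⊆ V' can be extended to a linear bijection φ_V : V → V' such that φ_V(A) = A', φ_V(B) = B', and φ_V(C) = C' if and only if φ(E ∩ (B+C)) = E' ∩ (B'+C'), φ(E ∩ (C+A)) = E' ∩ (C'+A'), and φ(E ∩ (A+B)) = E' ∩ (A'+B'). -/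
open Module

open Module Witt

/-- Two linear maps with the same kernel into spaces of equal finite dimension differ by a linear
equivalence of their targets. -/
theorem LinearMap.exists_linearEquiv_comp_eq_of_ker_eq {F U M M' : Type*} [Field F]
    [AddCommGroup U] [Module F U] [AddCommGroup M] [Module F M] [AddCommGroup M'] [Module F M']
    [FiniteDimensional F M] [FiniteDimensional F M'] (hd : finrank F M = finrank F M')
    (f : U →ₗ[F] M) (g : U →ₗ[F] M') (hker : f.ker = g.ker) :
    ∃ ψ : M ≃ₗ[F] M', ∀ u, ψ (f u) = g u := by
  obtain ⟨Q, hQ⟩ := Submodule.exists_isCompl f.range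
  obtain ⟨Q', hQ'⟩ := Submodule.exists_isCompl g.range
  let r : f.range ≃ₗ[F] g.range :=
    f.quotKerEquivRange.symm ≪≫ₗ Submodule.quotEquivOfEq _ _ hker ≪≫ₗ g.quotKerEquivRange
  have hr : ∀ u, r ⟨f u, u, rfl⟩ = ⟨g u, u, rfl⟩ := by
    intro u
    have h : f.quotKerEquivRange.symm ⟨f u, u, rfl⟩ = Submodule.Quotient.mk u :=
      (LinearEquiv.symm_apply_eq _).2 rfl
    simp only [r, LinearEquiv.trans_apply, h]
    rfl
  have hQd : finrank F Q = finrank F Q' := by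
    have h₁ := Submodule.finrank_add_eq_of_isCompl hQ
    have h₂ := Submodule.finrank_add_eq_of_isCompl hQ'
    have h₃ := r.finrank_eq
    omega
  refine ⟨(Submodule.prodEquivOfIsCompl _ _ hQ).symm ≪≫ₗ
    r.prodCongr (LinearEquiv.ofFinrankEq Q Q' hQd) ≪≫ₗ
    Submodule.prodEquivOfIsCompl _ _ hQ', fun u => ?_⟩
  have h : (Submodule.prodEquivOfIsCompl _ _ hQ).symm (f u) = (⟨f u, u, rfl⟩, 0) :=
    (LinearEquiv.symm_apply_eq _).2 (by simp)
  simp [h, hr]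

/-- An internal direct sum of three subspaces is linearly equivalent to their product, by
addition. -/
theorem Submodule.exists_prod_linearEquiv_of_three_summands {F V : Type*} [Field F]
    [AddCommGroup V] [Module F V] {A B C : Submodule F V}
    (hA : A ⊓ (B ⊔ C) = ⊥) (hB : B ⊓ (A ⊔ C) = ⊥)
    (hsum : A ⊔ B ⊔ C = ⊤) :
    ∃ e : (A × B × C) ≃ₗ[F] V, ∀ x, e x = (x.1 : V) + x.2.1 + x.2.2 := by
  let f : (A × B × C) →ₗ[F] V := A.subtype.coprod (B.subtype.coprod C.subtype)
  have hf : ∀ x, f x = (x.1 : V) + x.2.1 + x.2.2 := fun x => by simp [f, add_assoc]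
  refine ⟨LinearEquiv.ofBijective f ⟨?_, ?_⟩, hf⟩
  · rw [← LinearMap.ker_eq_bot, LinearMap.ker_eq_bot']
    rintro ⟨a, b, c⟩ h
    rw [hf] at h
    dsimp only at h
    have ha : (a : V) = 0 := by
      rw [← Submodule.mem_bot F, ← hA]
      refine ⟨a.2, ?_⟩
      rw [show (a : V) = -((b : V) + c) by rw [eq_neg_iff_add_eq_zero, ← h]; abel]
      exact neg_mem (add_mem (mem_sup_left b.2) (mem_sup_right c.2))
    have hb : (b : V) = 0 := by
      rw [← Submodule.mem_bot F, ← hB]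
      refine ⟨b.2, ?_⟩
      rw [show (b : V) = -((a : V) + c) by rw [eq_neg_iff_add_eq_zero, ← h]; abel]
      exact neg_mem (add_mem (mem_sup_left a.2) (mem_sup_right c.2))
    have hc : (c : V) = 0 := by simpa [ha, hb] using h
    simp only [Submodule.coe_eq_zero] at ha hb hc
    simp [ha, hb, hc]
  · intro v
    have hv : v ∈ A ⊔ B ⊔ C := hsum ▸ Submodule.mem_top
    obtain ⟨y, hy, c, hc, rfl⟩ := Submodule.mem_sup.1 hv
    obtain ⟨a, ha, b, hb, rfl⟩ := Submodule.mem_sup.1 hy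
    exact ⟨(⟨a, ha⟩, ⟨b, hb⟩, ⟨c, hc⟩), hf _⟩

/-- A sum `a + s` with `a ∈ A` and `s ∈ S`, where `A` and `S` are disjoint, lies in `S` iff
`a = 0`. -/
theorem Submodule.add_mem_iff_eq_zero_of_inf_eq_bot {F V : Type*} [Field F] [AddCommGroup V]
    [Module F V] {A S : Submodule F V} (h : A ⊓ S = ⊥) (a : A) {s : V} (hs : s ∈ S) :
    (a : V) + s ∈ S ↔ a = 0 := by
  rw [Submodule.add_mem_iff_left S hs, ← Submodule.coe_eq_zero, ← Submodule.mem_bot F, ← h]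
  simp

/-- Under an identification of `V` with `A × B × C` by addition, the sums of two of the summands
are the kernels of the coordinates. -/
theorem Submodule.mem_sup_iff_coord_eq_zero {F V : Type*} [Field F]
    [AddCommGroup V] [Module F V] {A B C : Submodule F V}
    (hA : A ⊓ (B ⊔ C) = ⊥) (hB : B ⊓ (A ⊔ C) = ⊥) (hC : C ⊓ (A ⊔ B) = ⊥)
    (e : (A × B × C) ≃ₗ[F] V) (he : ∀ x, e x = (x.1 : V) + x.2.1 + x.2.2) (v : V) :
    (v ∈ B ⊔ C ↔ (e.symm v).1 = 0) ∧ (v ∈ C ⊔ A ↔ (e.symm v).2.1 = 0) ∧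
      (v ∈ A ⊔ B ↔ (e.symm v).2.2 = 0) := by
  obtain ⟨⟨a, b, c⟩, rfl⟩ := e.surjective v
  rw [LinearEquiv.symm_apply_apply, he, sup_comm C A]
  refine ⟨?_, ?_, ?_⟩
  · rw [add_assoc]
    exact add_mem_iff_eq_zero_of_inf_eq_bot hA a
      (add_mem (mem_sup_left b.2) (mem_sup_right c.2))
  · rw [add_assoc, add_left_comm]
    exact add_mem_iff_eq_zero_of_inf_eq_bot hB b
      (add_mem (mem_sup_left a.2) (mem_sup_right c.2))
  · rw [add_comm]
    exact add_mem_iff_eq_zero_of_inf_eq_bot hC c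
      (add_mem (mem_sup_left a.2) (mem_sup_right b.2))

/-- A linear equivalence that sends `A` into `A'` sends it onto `A'` if the dimensions agree. -/
theorem Submodule.map_eq_of_forall_mem_of_finrank_eq {F V V' : Type*} [Field F]
    [AddCommGroup V] [Module F V] [AddCommGroup V'] [Module F V'] [FiniteDimensional F V']
    (ψ : V ≃ₗ[F] V') {A : Submodule F V} {A' : Submodule F V'}
    (hd : finrank F A = finrank F A') (h : ∀ a ∈ A, ψ a ∈ A') : A.map ψ.toLinearMap = A' :=
  Submodule.eq_of_le_of_finrank_eq (Submodule.map_le_iff_le_comap.2 h)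
    ((LinearEquiv.finrank_map_eq ψ A).trans hd)

/-- Lemma 4.4: given direct sum decompositions `V = A ⊕ B ⊕ C` and
`V' = A' ⊕ B' ⊕ C'` with matching dimensions, a linear bijection `φ : E → E'`
extends to a linear bijection `V → V'` sending `A` to `A'`, `B` to `B'` and
`C` to `C'` iff `φ(E ∩ (B+C)) = E' ∩ (B'+C')`, `φ(E ∩ (C+A)) = E' ∩ (C'+A')`
and `φ(E ∩ (A+B)) = E' ∩ (A'+B')`. -/
theorem extend_linear_bijection_three_summands {F V V' : Type*} [Field F]
    [AddCommGroup V] [Module F V] [AddCommGroup V'] [Module F V']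
    [FiniteDimensional F V] [FiniteDimensional F V']
    (A Bs C : Submodule F V) (A' Bs' C' : Submodule F V')
    (hdisjA : A ⊓ (Bs ⊔ C) = ⊥) (hdisjB : Bs ⊓ (A ⊔ C) = ⊥)
    (hdisjC : C ⊓ (A ⊔ Bs) = ⊥) (hsum : A ⊔ Bs ⊔ C = ⊤)
    (hdisjA' : A' ⊓ (Bs' ⊔ C') = ⊥) (hdisjB' : Bs' ⊓ (A' ⊔ C') = ⊥)
    (hdisjC' : C' ⊓ (A' ⊔ Bs') = ⊥) (hsum' : A' ⊔ Bs' ⊔ C' = ⊤)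
    (hdA : finrank F ↥A = finrank F ↥A') (hdB : finrank F ↥Bs = finrank F ↥Bs')
    (hdC : finrank F ↥C = finrank F ↥C')
    (E : Submodule F V) (E' : Submodule F V') (φ : E ≃ₗ[F] E') :
    (∃ φV : V ≃ₗ[F] V', (∀ e : E, φV (e : V) = (φ e : V')) ∧
        A.map φV.toLinearMap = A' ∧ Bs.map φV.toLinearMap = Bs' ∧
        C.map φV.toLinearMap = C') ↔
      ((∀ e : E, (e : V) ∈ Bs ⊔ C ↔ (φ e : V') ∈ Bs' ⊔ C') ∧
       (∀ e : E, (e : V) ∈ C ⊔ A ↔ (φ e : V') ∈ C' ⊔ A') ∧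
       (∀ e : E, (e : V) ∈ A ⊔ Bs ↔ (φ e : V') ∈ A' ⊔ Bs')) := by
  constructor
  · rintro ⟨φV, hφ, rfl, rfl, rfl⟩
    simp only [← Submodule.map_sup, ← hφ]
    have key : ∀ (S : Submodule F V) (v : V), v ∈ S ↔ φV v ∈ S.map φV.toLinearMap :=
      fun S v => by simp
    exact ⟨fun e => key _ _, fun e => key _ _, fun e => key _ _⟩
  · rintro ⟨h₁, h₂, h₃⟩
    obtain ⟨e, he⟩ := Submodule.exists_prod_linearEquiv_of_three_summands hdisjA hdisjB hsum
    obtain ⟨e', he'⟩ :=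
      Submodule.exists_prod_linearEquiv_of_three_summands hdisjA' hdisjB' hsum'
    have hm := Submodule.mem_sup_iff_coord_eq_zero hdisjA hdisjB hdisjC e he
    have hm' := Submodule.mem_sup_iff_coord_eq_zero hdisjA' hdisjB' hdisjC' e' he'
    let p : E →ₗ[F] A × Bs × C := e.symm.toLinearMap ∘ₗ E.subtype
    let q : E →ₗ[F] A' × Bs' × C' := e'.symm.toLinearMap ∘ₗ E'.subtype ∘ₗ φ.toLinearMap
    obtain ⟨ψA, hψA⟩ := LinearMap.exists_linearEquiv_comp_eq_of_ker_eq hdA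
      (LinearMap.fst F _ _ ∘ₗ p) (LinearMap.fst F _ _ ∘ₗ q)
      (Submodule.ext fun u => (hm u).1.symm.trans ((h₁ u).trans (hm' (φ u)).1))
    obtain ⟨ψB, hψB⟩ := LinearMap.exists_linearEquiv_comp_eq_of_ker_eq hdB
      (LinearMap.fst F _ _ ∘ₗ LinearMap.snd F _ _ ∘ₗ p)
      (LinearMap.fst F _ _ ∘ₗ LinearMap.snd F _ _ ∘ₗ q)
      (Submodule.ext fun u => (hm u).2.1.symm.trans ((h₂ u).trans (hm' (φ u)).2.1))
    obtain ⟨ψC, hψC⟩ := LinearMap.exists_linearEquiv_comp_eq_of_ker_eq hdC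
      (LinearMap.snd F _ _ ∘ₗ LinearMap.snd F _ _ ∘ₗ p)
      (LinearMap.snd F _ _ ∘ₗ LinearMap.snd F _ _ ∘ₗ q)
      (Submodule.ext fun u => (hm u).2.2.symm.trans ((h₃ u).trans (hm' (φ u)).2.2))
    let φV : V ≃ₗ[F] V' := e.symm ≪≫ₗ ψA.prodCongr (ψB.prodCongr ψC) ≪≫ₗ e'
    have hφV : ∀ (a : A) (b : Bs) (c : C), 
        φV ((a : V) + b + c) = (ψA a : V') + ψB b + ψC c := by
      intro a b c
      have h : e.symm ((a : V) + (b : V) + (c : V)) = (a, b, c) :=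
        (LinearEquiv.symm_apply_eq _).2 (he (a, b, c)).symm
      simp [φV, h, he']
    refine ⟨φV, fun u => ?_, Submodule.map_eq_of_forall_mem_of_finrank_eq φV hdA fun a ha => ?_,
      Submodule.map_eq_of_forall_mem_of_finrank_eq φV hdB fun b hb => ?_,
      Submodule.map_eq_of_forall_mem_of_finrank_eq φV hdC fun c hc => ?_⟩
    · change e' _ = _
      rw [← LinearEquiv.eq_symm_apply]
      exact Prod.ext (hψA u) (Prod.ext (hψB u) (hψC u))
    · have h := hφV ⟨a, ha⟩ 0 0
      simp only [map_zero, Submodule.coe_zero, add_zero] at h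
      exact h ▸ Subtype.prop _
    · have h := hφV 0 ⟨b, hb⟩ 0
      simp only [map_zero, Submodule.coe_zero, add_zero, zero_add] at h
      exact h ▸ Subtype.prop _
    · have h := hφV 0 0 ⟨c, hc⟩
      simp only [map_zero, Submodule.coe_zero, zero_add] at h
      exact h ▸ Subtype.prop _
end
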